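/- arXiv:math/0701890 — 3 statements merged into one kernel-verified Lean document; each statement's English description precedes it below -/
import Mathlib

section
/- Let N ≥ 1 with N ≡ 1 (mod 3). Then the complex transfer matrix ℝ_N (of size 2^{⌈N/2⌉}, with rows and columns indexed by subsets of {1,…,⌈N/2⌉}, and entry ℝ_N(C,D) = i^{|C|+|D|} if {1,…,⌊N/2⌋} = C ∪ D ∪ (C−1) ∪ (D−1), and 0 otherwise) is nilpotent: all its eigenvalues are 0, i.e. its characteristic polynomial is X^{2^{⌈N/2⌉}}. -/
open Polynomial

/-- The subset of `{1,…,m}` corresponding to a subset of `Fin m` (0-based shifted up by 1). -/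
def toOneBased {m : ℕ} (C : Finset (Fin m)) : Finset ℕ := C.image (fun k => k.val + 1)

/-- The transfer matrix `ℝ_N`, of size `2^⌈N/2⌉`, with rows and columns indexed by the
subsets of `{1,…,⌈N/2⌉}` (encoded as subsets of `Fin ⌈N/2⌉`): the entry in row `C` and
column `D` is `i^(|C|+|D|)` if `{1,…,⌊N/2⌋} = C ∪ D ∪ (C-1) ∪ (D-1)` (i.e. every element
of `{1,…,⌊N/2⌋}` belongs to `C ∪ D ∪ (C-1) ∪ (D-1)`; the elements `0` and, for `N` odd,
`⌈N/2⌉` of the latter union are immaterial), and `0` otherwise. -/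
def Rmat (N : ℕ) : Matrix (Finset (Fin ((N + 1) / 2))) (Finset (Fin ((N + 1) / 2))) ℂ :=
  fun C D =>
    if Finset.Icc 1 (N / 2) ⊆
        toOneBased C ∪ toOneBased D
          ∪ (toOneBased C).image (fun c => c - 1) ∪ (toOneBased D).image (fun d => d - 1)
    then Complex.I ^ (C.card + D.card) else 0

section aux
open scoped Classical
open Matrix

/-- All constraints `f` are met by `C` or `D`. -/
def auxCov {F V : Type} (r : F → V → Prop) (C D : V → Bool) : Prop :=
  ∀ f, ∃ v, r f v ∧ (C v = true ∨ D v = true)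

noncomputable def auxSg {V : Type} [Fintype V] (C : V → Bool) : ℂ :=
  ∏ v, if C v = true then -1 else 1

noncomputable def auxK {F V : Type} [Fintype V] (r : F → V → Prop) :
    Matrix (V → Bool) (V → Bool) ℂ :=
  Matrix.of fun C D => if auxCov r C D then auxSg C else 0

noncomputable def auxB {F V : Type} [Fintype V] (r : F → V → Prop) :
    Matrix (V → Bool) (F → Bool) ℂ :=
  Matrix.of fun C S => auxSg C * if (∃ f v, r f v ∧ C v = true ∧ S f = true) then 0 else 1

theorem aux_nil_comm {m n : Type} [Fintype m] [Fintype n] [DecidableEq m] [DecidableEq n]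
    (A : Matrix m n ℂ) (B : Matrix n m ℂ) (h : IsNilpotent (B * A)) : IsNilpotent (A * B) := by
  obtain ⟨k, hk⟩ := h
  refine ⟨k + 1, ?_⟩
  have key : ∀ k : ℕ, (A * B) ^ (k + 1) = A * (B * A) ^ k * B := by
    intro k
    induction k with
    | zero => simp
    | succ k ih => rw [pow_succ, ih, pow_succ (B * A)]; simp only [Matrix.mul_assoc]
  rw [key, hk]; simp

theorem auxK_eq {F V : Type} [Fintype V] [Fintype F] [DecidableEq F] (r : F → V → Prop) :
    auxK r = auxB r * auxB (fun v f => r f v) := by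
  ext C D
  simp only [auxK, auxB, Matrix.mul_apply, Matrix.of_apply]
  have h1 : ∀ S : F → Bool,
      (auxSg C * if (∃ f v, r f v ∧ C v = true ∧ S f = true) then (0:ℂ) else 1) *
      (auxSg S * if (∃ v f, r f v ∧ S f = true ∧ D v = true) then (0:ℂ) else 1) =
      auxSg C * ∏ f, (if S f = true then
        (if ∃ v, r f v ∧ (C v = true ∨ D v = true) then (0:ℂ) else -1) else 1) := by
    intro S
    by_cases h : ∃ f, S f = true ∧ ∃ v, r f v ∧ (C v = true ∨ D v = true)
    · have h0 := h
      obtain ⟨f, hS, hv⟩ := h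
      rw [Finset.prod_eq_zero (Finset.mem_univ f) (by rw [if_pos hS, if_pos hv])]
      obtain ⟨v, hr, hC | hD⟩ := hv
      · rw [if_pos ⟨f, v, hr, hC, hS⟩]; simp
      · rw [if_pos (c := ∃ v f, r f v ∧ S f = true ∧ D v = true) ⟨v, f, hr, hS, hD⟩]; simp
    · rw [if_neg (by rintro ⟨f, v, hr, hC, hS⟩; exact h ⟨f, hS, v, hr, Or.inl hC⟩),
        if_neg (by rintro ⟨v, f, hr, hS, hC⟩; exact h ⟨f, hS, v, hr, Or.inr hC⟩)]
      rw [mul_one, mul_one, auxSg, auxSg]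
      congr 1
      refine Finset.prod_congr rfl fun f _ => ?_
      by_cases hS : S f = true
      · rw [if_pos hS, if_pos hS, if_neg (fun hv => h ⟨f, hS, hv⟩)]
      · rw [if_neg hS, if_neg hS]
  refine Eq.trans ?_ (Finset.sum_congr rfl fun S _ => (h1 S).symm.trans (by congr!))
  rw [← Finset.mul_sum]
  have h2 := Finset.prod_univ_sum (fun _ : F => (Finset.univ : Finset Bool))
    (fun f b => if b = true then
        (if ∃ v, r f v ∧ (C v = true ∨ D v = true) then (0:ℂ) else -1) else 1)
  rw [Fintype.piFinset_univ] at h2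
  rw [← h2]
  by_cases h : auxCov r C D
  · rw [if_pos h, Finset.prod_eq_one, mul_one]
    intro f _
    simp [h f]
  · rw [if_neg h]
    unfold auxCov at h
    push Not at h
    obtain ⟨f, hf⟩ := h
    rw [Finset.prod_eq_zero (Finset.mem_univ f), mul_zero]
    have : ¬ ∃ v, r f v ∧ (C v = true ∨ D v = true) := by
      rintro ⟨v, hr, hv⟩
      have := hf v hr
      tauto
    simp [this]

theorem auxK_dual {F V : Type} [Fintype V] [Fintype F] [DecidableEq V] [DecidableEq F] (r : F → V → Prop)
    (h : IsNilpotent (auxK (fun v f => r f v))) : IsNilpotent (auxK r) := by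
  rw [auxK_eq]
  apply aux_nil_comm
  rw [auxK_eq] at h
  exact h

/-- chain incidence: `a` state rows, `b` constraint rows -/
def auxR (a b : ℕ) (f : Fin b) (v : Fin a) : Prop := v.val = f.val ∨ v.val = f.val + 1

theorem auxCov_step (a b : ℕ) (x y : Bool) (C D : Fin a → Bool) :
    auxCov (fun (v : Fin (b+2)) (f : Fin (a+1)) => auxR (b+2) (a+1) f v)
      (Fin.cons x C : Fin (a+1) → Bool) (Fin.cons y D : Fin (a+1) → Bool) ↔
      (x = true ∨ y = true) ∧ auxCov (auxR a b) C D := by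
  unfold auxCov auxR
  rw [Fin.forall_fin_succ, Fin.forall_fin_succ]
  simp only [Fin.exists_fin_succ, Fin.cons_zero, Fin.cons_succ, Fin.val_zero, Fin.val_succ]
  constructor
  · rintro ⟨h0, -, h⟩
    refine ⟨?_, fun f => ?_⟩
    · rcases h0 with h0 | ⟨i, hi, -⟩
      · exact h0.2
      · omega
    · rcases h f with h | ⟨i, hi, h⟩
      · omega
      · exact ⟨i, by omega, h⟩
  · rintro ⟨h0, h⟩
    refine ⟨Or.inl ⟨by simp, h0⟩, Or.inl ⟨by simp, h0⟩, fun f => ?_⟩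
    obtain ⟨i, hi, h⟩ := h f
    exact Or.inr ⟨i, by omega, h⟩

theorem aux_step (a b : ℕ) (h : IsNilpotent (auxK (auxR a b))) :
    IsNilpotent (auxK (auxR (b+2) (a+1))) := by
  apply auxK_dual
  let e : Bool × (Fin a → Bool) ≃ (Fin (a+1) → Bool) := Fin.consEquiv (fun _ => Bool)
  let M : Matrix Bool Bool ℂ := Matrix.of fun x y =>
    if x = true ∨ y = true then (if x = true then -1 else 1) else 0
  have hM : auxK (fun (v : Fin (b+2)) (f : Fin (a+1)) => auxR (b+2) (a+1) f v) =
      Matrix.reindexAlgEquiv ℂ ℂ e (Matrix.kroneckerMap (· * ·) M (auxK (auxR a b))) := by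
    rw [← (Matrix.reindexAlgEquiv ℂ ℂ e).symm_apply_eq]
    ext ⟨x, C⟩ ⟨y, D⟩
    have := auxCov_step a b x y C D
    simp only [Matrix.symm_reindexAlgEquiv, Matrix.coe_reindexAlgEquiv, Matrix.reindex_apply,
      Matrix.submatrix_apply, Matrix.kroneckerMap_apply, auxK, Matrix.of_apply, M,
      Equiv.symm_symm]
    change (if auxCov _ (Fin.cons x C : Fin (a+1) → Bool) (Fin.cons y D : Fin (a+1) → Bool)
      then auxSg (Fin.cons x C : Fin (a+1) → Bool) else 0) = _
    simp only [this, auxSg, Fin.prod_univ_succ, Fin.cons_zero, Fin.cons_succ]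
    by_cases h1 : (x = true ∨ y = true) <;> by_cases h2 : auxCov (auxR a b) C D <;> simp [h1, h2]
  rw [hM]
  obtain ⟨k, hk⟩ := h
  refine ⟨k, ?_⟩
  rw [← map_pow]
  have : ∀ k : ℕ, (Matrix.kroneckerMap (· * ·) M (auxK (auxR a b))) ^ k =
      Matrix.kroneckerMap (· * ·) (M ^ k) (auxK (auxR a b) ^ k) := by
    intro k
    induction k with
    | zero => simp
    | succ k ih => rw [pow_succ, ih, pow_succ, pow_succ, Matrix.mul_kronecker_mul]
  rw [this, hk]
  simp

theorem aux_base : IsNilpotent (auxK (auxR 1 0)) := by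
  apply auxK_dual
  refine ⟨1, ?_⟩
  rw [pow_one]
  ext C D
  simp [auxK, auxCov]

theorem aux_all (k : ℕ) : IsNilpotent (auxK (auxR ((3*k+1+1)/2) ((3*k+1)/2))) := by
  induction k with
  | zero => exact aux_base
  | succ k ih =>
    have := aux_step _ _ ih
    have e1 : (3*(k+1)+1+1)/2 = (3*k+1)/2+2 := by omega
    have e2 : (3*(k+1)+1)/2 = (3*k+1+1)/2+1 := by omega
    rw [e1, e2]; exact this

noncomputable def auxE (a : ℕ) : Finset (Fin a) ≃ (Fin a → Bool) where
  toFun C i := decide (i ∈ C)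
  invFun f := Finset.univ.filter fun i => f i = true
  left_inv C := by ext; simp
  right_inv f := by ext; simp

theorem auxSg_E (a : ℕ) (C : Finset (Fin a)) : auxSg (auxE a C) = Complex.I ^ C.card * Complex.I ^ C.card := by
  rw [← mul_pow, Complex.I_mul_I]
  simp [auxSg, auxE]

theorem aux_cond (N : ℕ) (C D : Finset (Fin ((N+1)/2))) :
    Finset.Icc 1 (N / 2) ⊆
        toOneBased C ∪ toOneBased D
          ∪ (toOneBased C).image (fun c => c - 1) ∪ (toOneBased D).image (fun d => d - 1) ↔
    auxCov (auxR ((N+1)/2) (N/2)) (auxE _ C) (auxE _ D) := by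
  simp only [Finset.subset_iff, auxCov, auxR, auxE, Equiv.coe_fn_mk, toOneBased, Finset.mem_union,
    Finset.mem_image, Finset.mem_Icc, decide_eq_true_eq, Finset.image_image, Function.comp]
  constructor
  · intro h f
    have := f.2
    rcases h (x := f.val + 1) ⟨by omega, by omega⟩ with ((⟨v, hv, h⟩ | ⟨v, hv, h⟩) | ⟨v, hv, h⟩) | ⟨v, hv, h⟩
    · exact ⟨v, by omega, Or.inl hv⟩
    · exact ⟨v, by omega, Or.inr hv⟩
    · exact ⟨v, by omega, Or.inl hv⟩
    · exact ⟨v, by omega, Or.inr hv⟩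
  · intro h x hx
    obtain ⟨v, h1 | h1, h2 | h2⟩ := h ⟨x - 1, by omega⟩ <;> simp only at h1
    · exact Or.inl (Or.inl (Or.inl ⟨v, h2, by omega⟩))
    · exact Or.inl (Or.inl (Or.inr ⟨v, h2, by omega⟩))
    · exact Or.inl (Or.inr ⟨v, h2, by omega⟩)
    · exact Or.inr ⟨v, h2, by omega⟩

theorem aux_Rmat_nil (N : ℕ) (hN3 : N % 3 = 1) : IsNilpotent (Rmat N) := by
  have hK : IsNilpotent (auxK (auxR ((N+1)/2) (N/2))) := by
    have := aux_all (N/3)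
    have e : 3 * (N/3) + 1 = N := by omega
    rwa [e] at this
  let d : Matrix (Finset (Fin ((N + 1) / 2))) (Finset (Fin ((N + 1) / 2))) ℂ :=
    Matrix.diagonal fun C => Complex.I ^ C.card
  let Q : Matrix (Finset (Fin ((N + 1) / 2))) (Finset (Fin ((N + 1) / 2))) ℂ :=
    Matrix.of fun C D => if auxCov (auxR ((N+1)/2) (N/2)) (auxE _ C) (auxE _ D)
      then Complex.I ^ C.card else 0
  have h2 : Rmat N = Q * d := by
    ext C D
    simp only [d, Q, Matrix.mul_diagonal, Rmat, aux_cond, Matrix.of_apply]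
    split_ifs <;> simp [pow_add]
  have h3 : d * Q = Matrix.reindexAlgEquiv ℂ ℂ (auxE _).symm (auxK (auxR ((N+1)/2) (N/2))) := by
    ext C D
    simp only [d, Q, Matrix.diagonal_mul, Matrix.of_apply, Matrix.coe_reindexAlgEquiv,
      Matrix.reindex_apply, Matrix.submatrix_apply, Equiv.symm_symm, auxK, auxSg_E]
    split_ifs <;> simp
  have h4 : IsNilpotent (d * Q) := by rw [h3]; exact hK.map _
  rw [h2]
  exact aux_nil_comm Q d h4

end aux

/-- For `N ≡ 1 (mod 3)`, the transfer matrix `ℝ_N` is nilpotent: its characteristic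
polynomial is `X^(2^⌈N/2⌉)`. -/
theorem Rmat_charpoly_N1 (N : ℕ) (hN : 1 ≤ N) (hN3 : N % 3 = 1) :
    (Rmat N).charpoly = X ^ (2 ^ ((N + 1) / 2)) := by
  have h := Matrix.isNilpotent_charpoly_sub_pow_of_isNilpotent (aux_Rmat_nil N hN3)
  have h' := sub_eq_zero.mp h.eq_zero
  simpa using h'
end

section
/- Let N ≥ 1 with N ≢ 1 (mod 3), and set n = ⌈N/3⌉ and j = e^{2iπ/3}. Then the characteristic polynomial of the complex transfer matrix ℝ_N equals X^{2^{⌈N/2⌉}−2ⁿ} · (X−1)^{(2ⁿ+2(−1)ⁿ)/3} · (X−j)^{(2ⁿ−(−1)ⁿ)/3} · (X−j²)^{(2ⁿ−(−1)ⁿ)/3}. In other words, ℝ_N has eigenvalue 0 with multiplicity 2^{⌈N/2⌉}−2ⁿ, eigenvalue 1 with multiplicity (2ⁿ+2(−1)ⁿ)/3, and eigenvalues j and j² each with multiplicity (2ⁿ−(−1)ⁿ)/3. -/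
open Polynomial

open Kronecker Matrix in
/-- Same characteristic polynomial up to powers of `X`, stably under Kronecker products. -/
def SRel {m n : Type} [Fintype m] [DecidableEq m] [Fintype n] [DecidableEq n]
    (M : Matrix m m ℂ) (M' : Matrix n n ℂ) : Prop :=
  ∀ (κ : Type) [Fintype κ] [DecidableEq κ] (K : Matrix κ κ ℂ),
    ∃ p q : ℕ, X ^ p * (K ⊗ₖ M).charpoly = X ^ q * (K ⊗ₖ M').charpoly

section rel
open Kronecker Matrix

variable {m n o : Type} [Fintype m] [DecidableEq m] [Fintype n] [DecidableEq n]
  [Fintype o] [DecidableEq o]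

theorem SRel.trans {M : Matrix m m ℂ} {M' : Matrix n n ℂ} {M'' : Matrix o o ℂ}
    (h : SRel M M') (h' : SRel M' M'') : SRel M M'' := by
  intro κ _ _ K
  obtain ⟨p, q, e⟩ := h κ K
  obtain ⟨p', q', e'⟩ := h' κ K
  refine ⟨p' + p, q + q', ?_⟩
  rw [pow_add, pow_add, mul_assoc, e, mul_left_comm, e', mul_assoc]

theorem SRel.symm {M : Matrix m m ℂ} {M' : Matrix n n ℂ}
    (h : SRel M M') : SRel M' M := by
  intro κ _ _ K
  obtain ⟨p, q, e⟩ := h κ K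
  exact ⟨q, p, e.symm⟩

theorem SRel.mul_comm (A : Matrix m n ℂ) (B : Matrix n m ℂ) : SRel (A * B) (B * A) := by
  intro κ _ _ K
  refine ⟨Fintype.card (κ × n), Fintype.card (κ × m), ?_⟩
  · have h1 : K ⊗ₖ (A * B) = (K ⊗ₖ A) * ((1 : Matrix κ κ ℂ) ⊗ₖ B) := by
      rw [← mul_kronecker_mul, mul_one]
    have h2 : K ⊗ₖ (B * A) = ((1 : Matrix κ κ ℂ) ⊗ₖ B) * (K ⊗ₖ A) := by
      rw [← mul_kronecker_mul, one_mul]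
    rw [h1, h2, charpoly_mul_comm']

theorem SRel.of_equiv {M : Matrix m m ℂ} {M' : Matrix n n ℂ} (e : m ≃ n)
    (h : ∀ i j, M i j = M' (e i) (e j)) : SRel M M' := by
  intro κ _ _ K
  refine ⟨0, 0, ?_⟩
  rw [← charpoly_reindex ((Equiv.refl κ).prodCongr e) (K ⊗ₖ M)]
  congr 2
  ext ⟨a, b⟩ ⟨c, d⟩
  simp [h]

theorem SRel.kron {M : Matrix m m ℂ} {M' : Matrix n n ℂ} (T : Matrix o o ℂ)
    (h : SRel M M') : SRel (T ⊗ₖ M) (T ⊗ₖ M') := by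
  intro κ _ _ K
  obtain ⟨p, q, e⟩ := h (κ × o) (K ⊗ₖ T)
  refine ⟨p, q, ?_⟩
  rw [← kronecker_assoc, ← kronecker_assoc, charpoly_reindex, charpoly_reindex, e]

theorem charpoly_kron_diag {κ : Type} [Fintype κ] [DecidableEq κ] (K : Matrix κ κ ℂ)
    (d : m → ℂ) : (K ⊗ₖ diagonal d).charpoly = ∏ i, (d i • K).charpoly := by
  have h : charmatrix (K ⊗ₖ diagonal d) = blockDiagonal fun i => charmatrix (d i • K) := by
    ext1 ⟨a, b⟩ ⟨c, e⟩
    simp only [charmatrix_apply, blockDiagonal_apply, kronecker_apply, diagonal_apply,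
      Prod.mk.injEq, Matrix.smul_apply, smul_eq_mul]
    by_cases h1 : b = e
    · subst h1; simp [mul_comm]
    · simp [h1]
  rw [charpoly, h, det_blockDiagonal]
  rfl

end rel

section bip
open Kronecker Matrix

/-- sign of a configuration -/
noncomputable def sg {S : Type} [Fintype S] (c : S → Bool) : ℂ :=
  ∏ s, if c s then (-1 : ℂ) else 1

open Classical in
/-- covering matrix -/
noncomputable def Amat {S P : Type} (I : S → P → Prop) :
    Matrix (S → Bool) (S → Bool) ℂ :=
  Matrix.of fun c d => if ∀ p, ∃ s, I s p ∧ (c s = true ∨ d s = true) then 1 else 0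

open Classical in
theorem Amat_apply {S P : Type} (I : S → P → Prop) (c d : S → Bool) :
    Amat I c d = if ∀ p, ∃ s, I s p ∧ (c s = true ∨ d s = true) then 1 else 0 := rfl

theorem ite_mul_ite' (p q : Prop) [Decidable p] [Decidable q] [Decidable (p ∧ q)] :
    (if p then (1 : ℂ) else 0) * (if q then 1 else 0) = if p ∧ q then 1 else 0 := by
  by_cases hp : p <;> by_cases hq : q <;> simp [hp, hq]

theorem ite_congr' {p q : Prop} {_ : Decidable p} {_ : Decidable q} (h : p ↔ q) :
    (if p then (1 : ℂ) else 0) = if q then 1 else 0 := by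
  by_cases hp : p
  · simp [hp, h.mp hp]
  · have hq : ¬ q := fun hq => hp (h.mpr hq)
    simp [hp, hq]

/-- diagonal sign matrix -/
noncomputable abbrev Zd (S : Type) [Fintype S] [DecidableEq S] :
    Matrix (S → Bool) (S → Bool) ℂ := diagonal sg

/-- transfer matrix of a bipartite graph -/
noncomputable def bip {S P : Type} [Fintype S] [DecidableEq S] (I : S → P → Prop) :
    Matrix (S → Bool) (S → Bool) ℂ :=
  Amat I * Zd S

variable {S P S' P' : Type} [Fintype S] [DecidableEq S] [Fintype P] [DecidableEq P]
  [Fintype S'] [DecidableEq S'] [Fintype P'] [DecidableEq P']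

set_option linter.unusedSectionVars false in
theorem bip_apply (I : S → P → Prop) (c d) : bip I c d = Amat I c d * sg d := by
  simp [bip]

open Classical in
theorem sum_sg (Q : P → Prop) :
    (∑ Y : P → Bool, sg Y * (if ∀ p, Y p = true → Q p then (1 : ℂ) else 0)) =
      if ∀ p, ¬ Q p then 1 else 0 := by
  have h : ∀ Y : P → Bool, sg Y * (if ∀ p, Y p = true → Q p then (1 : ℂ) else 0) =
      ∏ p, (if Y p then (if Q p then -1 else 0) else 1) := by
    intro Y
    have : (if ∀ p, Y p = true → Q p then (1 : ℂ) else 0) =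
        ∏ p, if (Y p = true → Q p) then (1 : ℂ) else 0 := by
      rw [Finset.prod_ite_zero]; simp
    rw [this, sg, ← Finset.prod_mul_distrib]
    refine Finset.prod_congr rfl fun p _ => ?_
    by_cases h1 : Y p = true <;> by_cases h2 : Q p <;> simp [h1, h2]
  simp_rw [h]
  have h3 := Finset.prod_univ_sum (fun _ : P => (Finset.univ : Finset Bool))
    (fun p b => if b then (if Q p then (-1 : ℂ) else 0) else 1)
  rw [Fintype.piFinset_univ] at h3
  rw [← h3]
  have h4 : ∀ p, (∑ b : Bool, if b then (if Q p then (-1 : ℂ) else 0) else 1) =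
      if ¬ Q p then 1 else 0 := by
    intro p
    by_cases h2 : Q p <;> simp [h2]
  simp_rw [h4]
  rw [Finset.prod_ite_zero]; simp

open Classical in
theorem bip_dual (I : S → P → Prop) : SRel (bip I) (bip fun p s => I s p) := by
  let B : Matrix (P → Bool) (S → Bool) ℂ :=
    Matrix.of fun Y c => if ∀ p s, Y p = true → c s = true → ¬ I s p then 1 else 0
  let Bt : Matrix (S → Bool) (P → Bool) ℂ := Matrix.of fun c Y => B Y c
  have hB : ∀ Y c, B Y c = if ∀ p s, Y p = true → c s = true → ¬ I s p then 1 else 0 :=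
    fun _ _ => rfl
  have hBt : ∀ Y c, Bt c Y = B Y c := fun _ _ => rfl
  have h1 : Amat I = Bt * Zd P * B := by
    ext c d
    rw [mul_apply]
    simp only [mul_diagonal, hBt]
    have : ∀ Y, B Y c * sg Y * B Y d = sg Y * (if ∀ p, Y p = true →
        (∀ s, I s p → ¬ (c s = true ∨ d s = true)) then (1 : ℂ) else 0) := by
      intro Y
      have : B Y c * B Y d = (if ∀ p, Y p = true →
        (∀ s, I s p → ¬ (c s = true ∨ d s = true)) then (1 : ℂ) else 0) := by
        simp only [hB]
        rw [ite_mul_ite']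
        apply ite_congr'
        grind
      rw [← this]; ring
    simp_rw [this]
    refine Eq.trans ?_ ((sum_sg _).symm.trans
      (Finset.sum_congr rfl fun Y _ => congrArg _ (ite_congr' Iff.rfl)))
    rw [Amat_apply]
    refine ite_congr' (forall_congr' fun p => ?_)
    rw [not_forall]
    simp only [Classical.not_imp, not_not]
  have h2 : Amat (fun p s => I s p) = B * Zd S * Bt := by
    ext c d
    rw [mul_apply]
    simp only [mul_diagonal, hBt]
    have : ∀ Y, B c Y * sg Y * B d Y = sg Y * (if ∀ s, Y s = true →
        (∀ p, I s p → ¬ (c p = true ∨ d p = true)) then (1 : ℂ) else 0) := by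
      intro Y
      have : B c Y * B d Y = (if ∀ s, Y s = true →
        (∀ p, I s p → ¬ (c p = true ∨ d p = true)) then (1 : ℂ) else 0) := by
        simp only [hB]
        rw [ite_mul_ite']
        apply ite_congr'
        grind
      rw [← this]; ring
    simp_rw [this]
    refine Eq.trans ?_ ((sum_sg _).symm.trans
      (Finset.sum_congr rfl fun Y _ => congrArg _ (ite_congr' Iff.rfl)))
    rw [Amat_apply]
    refine ite_congr' (forall_congr' fun p => ?_)
    rw [not_forall]
    simp only [Classical.not_imp, not_not]
  have := SRel.mul_comm (Bt * Zd P) (B * Zd S)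
  rw [bip, bip, h1, h2]
  simpa only [Matrix.mul_assoc] using this

theorem bip_iso (I : S → P → Prop) (J : S' → P' → Prop) (f : S ≃ S') (g : P ≃ P')
    (h : ∀ s p, I s p ↔ J (f s) (g p)) : SRel (bip I) (bip J) := by
  refine SRel.of_equiv (f.arrowCongr (Equiv.refl Bool)) ?_
  intro c d
  rw [bip_apply, bip_apply]
  congr 1
  · simp only [Amat_apply]
    apply ite_congr'
    rw [g.forall_congr_left]
    refine forall_congr' fun p => ?_
    rw [f.exists_congr_left]
    simp [h]
  · simp only [sg]
    rw [← f.symm.prod_comp]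
    rfl

theorem bip_sum (I : S → P → Prop) (J : S' → P' → Prop) (H : S ⊕ S' → P ⊕ P' → Prop)
    (h1 : ∀ s p, H (.inl s) (.inl p) ↔ I s p) (h2 : ∀ s p, H (.inr s) (.inr p) ↔ J s p)
    (h3 : ∀ s p, ¬ H (.inl s) (.inr p)) (h4 : ∀ s p, ¬ H (.inr s) (.inl p)) :
    SRel (bip H) (bip I ⊗ₖ bip J) := by
  refine SRel.of_equiv (Equiv.sumArrowEquivProdArrow S S' Bool) ?_
  intro c d
  rw [kronecker_apply, bip_apply, bip_apply, bip_apply, mul_mul_mul_comm]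
  congr 1
  · classical
    simp only [Amat_apply]
    rw [ite_mul_ite']
    apply ite_congr'
    simp [Equiv.sumArrowEquivProdArrow, h1, h2, h3, h4]
  · simp only [sg, Fintype.prod_sum_type]
    rfl

theorem sg_update (c : S → Bool) (s : S) : sg (Function.update c s (!c s)) = - sg c := by
  simp only [sg]
  rw [← Finset.mul_prod_erase _ _ (Finset.mem_univ s),
    ← Finset.mul_prod_erase Finset.univ (fun s => if c s then (-1 : ℂ) else 1) (Finset.mem_univ s)]
  have : ∏ x ∈ Finset.univ.erase s, (if Function.update c s (!c s) x then (-1 : ℂ) else 1) =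
      ∏ x ∈ Finset.univ.erase s, (if c x then (-1 : ℂ) else 1) := by
    refine Finset.prod_congr rfl fun x hx => ?_
    rw [Function.update_of_ne (Finset.ne_of_mem_erase hx)]
  rw [this]
  cases h : c s <;> simp

theorem bip_fold (I : Option S → P → Prop) (s₁ : S) (h : ∀ p, I (some s₁) p → I none p) :
    SRel (bip I) (bip fun s p => I (some s) p) := by
  let q : (Option S → Bool) → (Option S → Bool) :=
    fun c => if c none then Function.update c (some s₁) false else c
  let ex : (S → Bool) → (Option S → Bool) := fun c o => o.elim false c
  have hqn : ∀ c, q c none = c none := by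
    intro c; by_cases hc : c none = true <;> simp [q, hc]
  have hA : ∀ c d, Amat I c d = Amat I (q c) (q d) := by
    intro c d
    simp only [Amat_apply]
    apply ite_congr'
    refine forall_congr' fun p => ?_
    constructor
    · rintro ⟨s, hs, hcd⟩
      by_cases h0 : I none p ∧ (c none = true ∨ d none = true)
      · exact ⟨none, h0.1, by rw [hqn, hqn]; exact h0.2⟩
      · refine ⟨s, hs, ?_⟩
        by_cases e : s = some s₁
        · subst e
          have := h p hs
          have hc : ¬ c none = true := by tauto
          have hd : ¬ d none = true := by tauto
          simpa [q, hc, hd] using hcd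
        · simp only [q]
          split_ifs <;> simpa [Function.update_of_ne e] using hcd
    · rintro ⟨s, hs, hcd⟩
      refine ⟨s, hs, ?_⟩
      by_cases e : s = some s₁
      · subst e
        simp only [q] at hcd
        by_cases hc : c none = true <;> by_cases hd : d none = true <;>
          simp [hc, hd] at hcd <;> tauto
      · simp only [q] at hcd
        split_ifs at hcd <;> simpa [Function.update_of_ne e] using hcd
  let Q : Matrix (Option S → Bool) (Option S → Bool) ℂ :=
    Matrix.of fun c e => if q c = e then 1 else 0
  let Qt : Matrix (Option S → Bool) (Option S → Bool) ℂ := Matrix.of fun e c => Q c e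
  let E : Matrix (Option S → Bool) (S → Bool) ℂ :=
    Matrix.of fun c e => if c = ex e then 1 else 0
  let Et : Matrix (S → Bool) (Option S → Bool) ℂ := Matrix.of fun e c => E c e
  have hQe : ∀ c e, Q c e = if q c = e then 1 else 0 := fun _ _ => rfl
  have hQt : ∀ c e, Qt e c = Q c e := fun _ _ => rfl
  have hEe : ∀ c e, E c e = if c = ex e then 1 else 0 := fun _ _ => rfl
  have hEt : ∀ c e, Et e c = E c e := fun _ _ => rfl
  have hQ : Amat I = Q * (Amat I * Qt) := by
    ext c d
    simp [mul_apply, hQt, hQe, ← hA]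
  have hsgex : ∀ e, sg (ex e) = sg e := by
    intro e; simp only [sg, ex, Fintype.prod_option]
    change (if false = true then (-1 : ℂ) else 1) * ∏ s, (if e s = true then (-1 : ℂ) else 1) = _
    rw [if_neg (by simp), one_mul]
  have hW : Qt * Zd (Option S) * Q = E * Zd S * Et := by
    ext x y
    rw [mul_apply, mul_apply]
    simp only [mul_diagonal, hQt, hEt, hQe, hEe]
    by_cases hxy : x = y
    swap
    · rw [Finset.sum_eq_zero, Finset.sum_eq_zero]
      · intro e _
        by_cases h1 : x = ex e
        · have : y ≠ ex e := fun h2 => hxy (h1.trans h2.symm)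
          simp [this]
        · simp [h1]
      · intro e _
        by_cases h1 : q e = x
        · have : q e ≠ y := fun h2 => hxy (h1.symm.trans h2)
          simp [this]
        · simp [h1]
    subst hxy
    by_cases hx : x none = true
    · have hR : ∀ e, x ≠ ex e := by
        intro e he
        rw [he] at hx
        simp [ex] at hx
      simp only [hR, if_false, zero_mul, Finset.sum_const_zero]
      let τ : (Option S → Bool) → (Option S → Bool) :=
        fun c => Function.update c (some s₁) (!c (some s₁))
      have hτ : Function.Involutive τ := by
        intro c
        simp [τ]
      have hq : ∀ c, q c = x ↔ q (τ c) = x := by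
        intro c
        by_cases hc : c none = true
        · simp [q, τ, hc]
        · have h1 : q c ≠ x := fun e => hc (by rw [← hqn c, e, hx])
          have h2 : q (τ c) ≠ x := fun e => hc (by
            have := hqn (τ c)
            rw [e, hx] at this
            simpa [τ] using this.symm)
          simp [h1, h2]
      let f : (Option S → Bool) → ℂ :=
        fun c => (if q c = x then (1 : ℂ) else 0) * sg c * if q c = x then 1 else 0
      have hs : ∑ c, f (τ c) = ∑ c, f c := Equiv.sum_comp hτ.toPerm f
      have hneg : ∀ c, f (τ c) = - f c := by
        intro c
        simp only [f, ite_congr' (hq c)]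
        rw [show sg (τ c) = - sg c from sg_update _ _]
        ring
      simp only [hneg, Finset.sum_neg_distrib] at hs
      exact self_eq_neg.mp hs.symm
    · have hxe : x = ex (fun s => x (some s)) := by
        funext o
        cases o <;> simp [ex, hx]
      have hinj : ∀ e, x = ex e ↔ (fun s => x (some s)) = e := by
        intro e
        constructor
        · intro h1; rw [h1]; rfl
        · intro h1; rw [← h1]; exact hxe
      have hqx : ∀ c, q c = x ↔ c = x := by
        intro c
        by_cases hc : c none = true
        · constructor
          · intro e; rw [← e, hqn] at hx; exact absurd hc hx
          · intro e; rw [e] at hc; exact absurd hc hx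
        · simp [q, hc]
      simp only [hinj, hqx]
      simp [← hsgex, ← hxe]
  have h1 := SRel.mul_comm Q (Amat I * Qt * Zd (Option S))
  have h2 := SRel.mul_comm (Amat I * E * Zd S) Et
  have e1 : Q * (Amat I * Qt * Zd (Option S)) = bip I := by
    rw [bip]
    conv_rhs => rw [hQ]
    simp only [Matrix.mul_assoc]
  have e2 : Amat I * Qt * Zd (Option S) * Q = Amat I * E * Zd S * Et := by
    have := congrArg (fun M => Amat I * M) hW
    simpa only [Matrix.mul_assoc] using this
  have e3 : Et * (Amat I * E * Zd S) = bip fun s p => I (some s) p := by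
    have : Et * (Amat I * E) = Amat fun s p => I (some s) p := by
      ext c d
      have : (Et * (Amat I * E)) c d = Amat I (ex c) (ex d) := by
        simp [mul_apply, hEt, hEe]
      rw [this]
      rw [Amat_apply, Amat_apply]
      refine ite_congr' (forall_congr' fun p => ?_)
      simp [ex, Option.exists]
    rw [bip, ← this]
    simp only [Matrix.mul_assoc]
  rw [e1, e2] at h1
  rw [e3] at h2
  exact h1.trans h2

end bip

section path
open Kronecker Matrix

theorem SRel.kron_right {m n o : Type} [Fintype m] [DecidableEq m] [Fintype n] [DecidableEq n]
    [Fintype o] [DecidableEq o] {M : Matrix m m ℂ} {M' : Matrix n n ℂ} (T : Matrix o o ℂ)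
    (h : SRel M M') : SRel (M ⊗ₖ T) (M' ⊗ₖ T) := by
  have h1 : SRel (M ⊗ₖ T) (T ⊗ₖ M) := SRel.of_equiv (Equiv.prodComm _ _) (by
    rintro ⟨a, b⟩ ⟨c, d⟩; simp [_root_.mul_comm])
  have h2 : SRel (T ⊗ₖ M') (M' ⊗ₖ T) := SRel.of_equiv (Equiv.prodComm _ _) (by
    rintro ⟨a, b⟩ ⟨c, d⟩; simp [_root_.mul_comm])
  exact (h1.trans (h.kron T)).trans h2

/-- incidence relation of the path -/
def pI (N : ℕ) : Fin ((N + 1) / 2) → Fin (N / 2) → Prop :=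
  fun s p => s.val = p.val ∨ s.val = p.val + 1

/-- the edge -/
noncomputable def Tmat : Matrix (Unit → Bool) (Unit → Bool) ℂ :=
  bip (fun (_ _ : Unit) => True)

theorem pI_step (N : ℕ) : SRel (bip (pI (N + 3))) (Tmat ⊗ₖ bip (pI N)) := by
  let f₀ : Option (Unit ⊕ Fin (N / 2)) → Fin ((N + 3 + 1) / 2) := fun o =>
    match o with
    | none => ⟨1, by omega⟩
    | some (.inl _) => ⟨0, by omega⟩
    | some (.inr i) => ⟨i.val + 2, by have := i.isLt; omega⟩
  let g₀ : Unit ⊕ Fin ((N + 1) / 2) → Fin ((N + 3) / 2) := fun o =>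
    match o with
    | .inl _ => ⟨0, by omega⟩
    | .inr i => ⟨i.val + 1, by have := i.isLt; omega⟩
  have hf : Function.Bijective f₀ := by
    constructor
    · rintro (_ | _ | i) (_ | _ | j) h <;> simp [f₀, Fin.ext_iff] at h ⊢
      exact h
    · rintro ⟨i, hi⟩
      match i, hi with
      | 0, _ => exact ⟨some (.inl ()), rfl⟩
      | 1, _ => exact ⟨none, rfl⟩
      | i + 2, hi => exact ⟨some (.inr ⟨i, by omega⟩), rfl⟩
  have hg : Function.Bijective g₀ := by
    constructor
    · rintro (_ | i) (_ | j) h <;> simp [g₀, Fin.ext_iff] at h ⊢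
      exact h
    · rintro ⟨i, hi⟩
      match i, hi with
      | 0, _ => exact ⟨.inl (), rfl⟩
      | i + 1, hi => exact ⟨.inr ⟨i, by omega⟩, rfl⟩
  let f := Equiv.ofBijective f₀ hf
  let g := Equiv.ofBijective g₀ hg
  have h1 : SRel (bip (pI (N + 3))) (bip fun s p => pI (N + 3) (f s) (g p)) :=
    (bip_iso _ _ f g (fun _ _ => Iff.rfl)).symm
  have h2 := bip_fold (fun s p => pI (N + 3) (f s) (g p)) (.inl ()) (by
    rintro (_ | p) <;> simp [pI, f, g, f₀, g₀])
  have h3 := bip_sum (fun (_ _ : Unit) => True) (fun s p => pI N p s)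
    (fun s p => pI (N + 3) (f (some s)) (g p))
    (by intro s p; simp [pI, f, g, f₀, g₀])
    (by intro s p; simp only [pI, f, g, f₀, g₀, Equiv.ofBijective_apply]; omega)
    (by intro s p; simp [pI, f, g, f₀, g₀])
    (by intro s p; simp [pI, f, g, f₀, g₀])
  have h4 := bip_dual (fun s p => pI N p s)
  exact ((h1.trans h2).trans h3).trans (h4.kron _)

theorem Tmat_diag (j : ℂ) (hj : j ^ 2 + j + 1 = 0) :
    SRel Tmat (diagonal ![j, j ^ 2]) := by
  have hne : j ^ 2 - j ≠ 0 := by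
    intro h
    have h1 : 2 * j = -1 := by linear_combination hj - h
    have h2 : (3 : ℂ) = 0 := by linear_combination 4 * hj - (2 * j + 1) * h1
    norm_num at h2
  let T : Matrix (Fin 2) (Fin 2) ℂ := !![0, -1; 1, -1]
  let P : Matrix (Fin 2) (Fin 2) ℂ := !![1, 1; -j, -j ^ 2]
  have hT : SRel Tmat T := by
    let e : (Unit → Bool) ≃ Fin 2 := (Equiv.funUnique Unit Bool).trans finTwoEquiv.symm
    refine SRel.of_equiv e ?_
    intro c d
    rw [Tmat, bip_apply, Amat_apply]
    have hc : c = fun _ => c () := by funext x; rfl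
    have hd : d = fun _ => d () := by funext x; rfl
    generalize c () = c0 at hc
    generalize d () = d0 at hd
    subst hc hd
    cases c0 <;> cases d0 <;> simp [sg, e, T, finTwoEquiv]
  have hP : IsUnit P.det := by
    rw [isUnit_iff_ne_zero]
    simp only [P, det_fin_two_of]
    intro h
    apply hne
    linear_combination -h
  have hTP : T * P = P * diagonal ![j, j ^ 2] := by
    ext a b
    fin_cases a <;> fin_cases b <;> simp [T, P, mul_apply, Fin.sum_univ_two, diagonal]
    · linear_combination hj
    · linear_combination (j ^ 2 - j + 1) * hj
  have e1 : P * (diagonal ![j, j ^ 2] * P⁻¹) = T := by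
    rw [← Matrix.mul_assoc, ← hTP, Matrix.mul_assoc, mul_nonsing_inv _ hP, Matrix.mul_one]
  have e2 : diagonal ![j, j ^ 2] * P⁻¹ * P = diagonal ![j, j ^ 2] := by
    rw [Matrix.mul_assoc, nonsing_inv_mul _ hP, Matrix.mul_one]
  have h := SRel.mul_comm P (diagonal ![j, j ^ 2] * P⁻¹)
  rw [e1, e2] at h
  exact hT.trans h

/-- the charpoly claim -/
def Pc (j : ℂ) {m : Type} [Fintype m] [DecidableEq m] (M : Matrix m m ℂ) (a b : ℕ) : Prop :=
  ∀ (κ : Type) [Fintype κ] [DecidableEq κ] (K : Matrix κ κ ℂ),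
    ∃ p q : ℕ, X ^ p * (K ⊗ₖ M).charpoly =
      X ^ q * (K.charpoly ^ a * (j • K).charpoly ^ b * (j ^ 2 • K).charpoly ^ b)

theorem Pc_of_SRel (j : ℂ) {m n : Type} [Fintype m] [DecidableEq m] [Fintype n] [DecidableEq n]
    {M : Matrix m m ℂ} {M' : Matrix n n ℂ} {a b : ℕ} (h : SRel M M') (h' : Pc j M' a b) :
    Pc j M a b := by
  intro κ _ _ K
  obtain ⟨p, q, e⟩ := h κ K
  obtain ⟨p', q', e'⟩ := h' κ K
  refine ⟨p' + p, q + q', ?_⟩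
  rw [pow_add, pow_add, mul_assoc, e, mul_left_comm, e']
  ring

theorem Pc_step (j : ℂ) (hj : j ^ 2 + j + 1 = 0) {m : Type} [Fintype m] [DecidableEq m]
    {M : Matrix m m ℂ} {a b : ℕ} (h : Pc j M a b) :
    Pc j (diagonal ![j, j ^ 2] ⊗ₖ M) (2 * b) (a + b) := by
  intro κ _ _ K
  obtain ⟨p, q, e⟩ := h _ (K ⊗ₖ diagonal ![j, j ^ 2])
  refine ⟨p, q, ?_⟩
  have hj3 : j ^ 3 = 1 := by linear_combination (j - 1) * hj
  have hj4 : j ^ 4 = j := by linear_combination j * hj3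
  rw [← kronecker_assoc, charpoly_reindex, e, ← smul_kronecker, ← smul_kronecker,
    charpoly_kron_diag, charpoly_kron_diag, charpoly_kron_diag]
  simp only [Fin.prod_univ_two, cons_val_zero, cons_val_one, smul_smul, ← pow_succ, ← pow_succ',
    ← pow_add, hj3, hj4, one_smul, Nat.reduceAdd]
  ring

theorem Pc_pI (j : ℂ) (hj : j ^ 2 + j + 1 = 0) {N a b : ℕ} (h : Pc j (bip (pI N)) a b) :
    Pc j (bip (pI (N + 3))) (2 * b) (a + b) :=
  Pc_of_SRel j ((pI_step N).trans ((Tmat_diag j hj).kron_right _)) (Pc_step j hj h)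

theorem Pc_zero (j : ℂ) : Pc j (bip (pI 0)) 1 0 := by
  have h : SRel (bip (pI 0)) (diagonal fun _ : Unit => (1 : ℂ)) := by
    have : IsEmpty (Fin ((0 + 1) / 2)) := inferInstanceAs (IsEmpty (Fin 0))
    refine SRel.of_equiv (Equiv.ofUnique _ _) ?_
    intro c d
    rw [bip_apply, Amat_apply, if_pos]
    · simp [sg]
    · intro p; exact p.elim0
  refine Pc_of_SRel j h ?_
  intro κ _ _ K
  refine ⟨0, 0, ?_⟩
  rw [charpoly_kron_diag]
  simp

theorem Pc_two (j : ℂ) (hj : j ^ 2 + j + 1 = 0) : Pc j (bip (pI 2)) 0 1 := by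
  have h : SRel (bip (pI 2)) Tmat := by
    refine bip_iso _ _ finOneEquiv finOneEquiv ?_
    intro s p
    have := s.isLt
    have := p.isLt
    simp only [pI, iff_true]
    omega
  refine Pc_of_SRel j (h.trans (Tmat_diag j hj)) ?_
  intro κ _ _ K
  refine ⟨0, 0, ?_⟩
  rw [charpoly_kron_diag]
  simp

theorem Pc_all (j : ℂ) (hj : j ^ 2 + j + 1 = 0) (k : ℕ) :
    (∃ a b : ℕ, Pc j (bip (pI (3 * k))) a b ∧ (3 * a : ℤ) = 2 ^ k + 2 * (-1) ^ k ∧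
      (3 * b : ℤ) = 2 ^ k - (-1) ^ k) ∧
    (∃ a b : ℕ, Pc j (bip (pI (3 * k + 2))) a b ∧
      (3 * a : ℤ) = 2 ^ (k + 1) + 2 * (-1) ^ (k + 1) ∧
      (3 * b : ℤ) = 2 ^ (k + 1) - (-1) ^ (k + 1)) := by
  induction k with
  | zero => exact ⟨⟨1, 0, Pc_zero j, by norm_num⟩, ⟨0, 1, Pc_two j hj, by norm_num⟩⟩
  | succ k ih =>
    obtain ⟨⟨a, b, h, ha, hb⟩, ⟨a', b', h', ha', hb'⟩⟩ := ih
    refine ⟨⟨2 * b, a + b, Pc_pI j hj h, ?_⟩, ⟨2 * b', a' + b', Pc_pI j hj h', ?_⟩⟩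
    · push_cast; rw [pow_succ, pow_succ]; constructor <;> linarith
    · push_cast; rw [pow_succ _ (k + 1), pow_succ _ (k + 1)]; constructor <;> linarith

theorem Rmat_SRel (N : ℕ) : SRel (Rmat N) (bip (pI N)) := by
  let u : (Fin ((N + 1) / 2) → Bool) → ℂ := fun c => ∏ s, if c s = true then Complex.I else 1
  let U : Matrix (Fin ((N + 1) / 2) → Bool) (Fin ((N + 1) / 2) → Bool) ℂ := diagonal u
  let e : Finset (Fin ((N + 1) / 2)) ≃ (Fin ((N + 1) / 2) → Bool) :=
    { toFun := fun C s => decide (s ∈ C)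
      invFun := fun c => Finset.univ.filter fun s => c s = true
      left_inv := fun C => by ext; simp
      right_inv := fun c => by funext; simp }
  have hu : ∀ C, u (e C) = Complex.I ^ C.card := by
    intro C
    simp [u, e, Finset.prod_ite]
  have h1 : SRel (Rmat N) (U * (Amat (pI N) * U)) := by
    refine SRel.of_equiv e ?_
    intro C D
    have : (U * (Amat (pI N) * U)) (e C) (e D) = u (e C) * (Amat (pI N) (e C) (e D) * u (e D)) := by
      simp only [U, diagonal_mul, mul_diagonal]
    rw [this, hu, hu, Amat_apply, Rmat, pow_add]
    have hiff : (Finset.Icc 1 (N / 2) ⊆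
        toOneBased C ∪ toOneBased D
          ∪ (toOneBased C).image (fun c => c - 1) ∪ (toOneBased D).image (fun d => d - 1)) ↔
        ∀ p, ∃ s, pI N s p ∧ (e C s = true ∨ e D s = true) := by
      simp only [Finset.subset_iff, Finset.mem_Icc, Finset.mem_union, toOneBased, Finset.mem_image,
        pI, e, Equiv.coe_fn_mk, decide_eq_true_eq]
      constructor
      · intro h p
        rcases h (x := p.val + 1) ⟨by omega, by have := p.isLt; omega⟩ with
          ((⟨s, hs, h2⟩ | ⟨s, hs, h2⟩) | ⟨_, ⟨s, hs, rfl⟩, h2⟩) | ⟨_, ⟨s, hs, rfl⟩, h2⟩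
        · exact ⟨s, by omega, .inl hs⟩
        · exact ⟨s, by omega, .inr hs⟩
        · exact ⟨s, by omega, .inl hs⟩
        · exact ⟨s, by omega, .inr hs⟩
      · rintro h x ⟨hx1, hx2⟩
        obtain ⟨s, hs1, hs2⟩ := h ⟨x - 1, by omega⟩
        simp only at hs1
        rcases hs1 with hs1 | hs1 <;> rcases hs2 with hs2 | hs2
        · exact .inl (.inl (.inl ⟨s, hs2, by omega⟩))
        · exact .inl (.inl (.inr ⟨s, hs2, by omega⟩))
        · exact .inl (.inr ⟨_, ⟨s, hs2, rfl⟩, by omega⟩)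
        · exact .inr ⟨_, ⟨s, hs2, rfl⟩, by omega⟩
    by_cases h : ∀ p, ∃ s, pI N s p ∧ (e C s = true ∨ e D s = true)
    · rw [if_pos h, if_pos (hiff.mpr h), one_mul]
    · rw [if_neg h, if_neg (fun h' => h (hiff.mp h')), zero_mul, mul_zero]
  have h2 := SRel.mul_comm U (Amat (pI N) * U)
  have h3 : Amat (pI N) * U * U = bip (pI N) := by
    rw [bip, Matrix.mul_assoc]
    congr 1
    simp only [U, Zd, diagonal_mul_diagonal]
    congr 1
    funext c
    simp only [u, sg, ← Finset.prod_mul_distrib]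
    refine Finset.prod_congr rfl fun s _ => ?_
    by_cases hs : c s = true <;> simp [hs]
  rw [h3] at h2
  exact h1.trans h2

end path

/-- For `N ≢ 1 (mod 3)`, with `n = ⌈N/3⌉` and `j = e^(2iπ/3)`, the characteristic
polynomial of `ℝ_N` is `X^(2^⌈N/2⌉-2^n) (X-1)^a (X-j)^b (X-j²)^b`, where
`a = (2^n+2(-1)^n)/3` and `b = (2^n-(-1)^n)/3`. -/
theorem Rmat_charpoly (N : ℕ) (hN : 1 ≤ N) (hN3 : N % 3 ≠ 1) (n a b : ℕ)
    (hn : n = (N + 2) / 3)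
    (ha : (3 * a : ℤ) = 2 ^ n + 2 * (-1) ^ n)
    (hb : (3 * b : ℤ) = 2 ^ n - (-1) ^ n) :
    (Rmat N).charpoly =
      X ^ (2 ^ ((N + 1) / 2) - 2 ^ n) * (X - C 1) ^ a
        * (X - C (Complex.exp (2 * Real.pi * Complex.I / 3))) ^ b
        * (X - C ((Complex.exp (2 * Real.pi * Complex.I / 3)) ^ 2)) ^ b := by
  have hprim : IsPrimitiveRoot (Complex.exp (2 * Real.pi * Complex.I / 3)) 3 := by
    simpa using Complex.isPrimitiveRoot_exp 3 (by norm_num)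
  generalize Complex.exp (2 * Real.pi * Complex.I / 3) = j at hprim ⊢
  have hj : j ^ 2 + j + 1 = 0 := by
    have h1 : j ≠ 1 := hprim.ne_one (by norm_num)
    have h3 : j ^ 3 = 1 := hprim.pow_eq_one
    have h4 : (j - 1) * (j ^ 2 + j + 1) = 0 := by linear_combination h3
    exact (mul_eq_zero.mp h4).resolve_left (sub_ne_zero.mpr h1)
  have hPc : Pc j (bip (pI N)) a b := by
    obtain ⟨⟨a₁, b₁, h₁, ha₁, hb₁⟩, ⟨a₂, b₂, h₂, ha₂, hb₂⟩⟩ := Pc_all j hj (N / 3)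
    rcases (by omega : N = 3 * (N / 3) ∨ N = 3 * (N / 3) + 2) with h | h
    · have : n = N / 3 := by omega
      rw [this] at ha hb
      have e1 : a = a₁ := by omega
      have e2 : b = b₁ := by omega
      rw [e1, e2, h]; exact h₁
    · have : n = N / 3 + 1 := by omega
      rw [this] at ha hb
      have e1 : a = a₂ := by omega
      have e2 : b = b₂ := by omega
      rw [e1, e2, h]; exact h₂
  have hPc' := Pc_of_SRel j (Rmat_SRel N) hPc
  obtain ⟨p, q, e⟩ := hPc' Unit 1
  have hcp : ∀ z : ℂ, (z • (1 : Matrix Unit Unit ℂ)).charpoly = X - C z := by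
    intro z
    simp [Matrix.charpoly, Matrix.charmatrix]
  have hcp1 : (1 : Matrix Unit Unit ℂ).charpoly = X - C 1 := by
    rw [← hcp 1, one_smul]
  have hR : (Matrix.kroneckerMap (fun x y => x * y) (1 : Matrix Unit Unit ℂ) (Rmat N)).charpoly =
      (Rmat N).charpoly := by
    rw [← Matrix.charpoly_reindex (Equiv.punitProd _)]
    congr 1
    ext c d
    simp [Matrix.reindex_apply]
  rw [hR, hcp, hcp, hcp1] at e
  have hdeg := congrArg natDegree e
  have hab : a + b + b = 2 ^ n := by
    have : ((a + b + b : ℕ) : ℤ) = ((2 ^ n : ℕ) : ℤ) := by push_cast; linarith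
    exact_mod_cast this
  have hmon : ((X - C 1) ^ a * (X - C j) ^ b * (X - C (j ^ 2)) ^ b : ℂ[X]).Monic :=
    (((monic_X_sub_C _).pow _).mul ((monic_X_sub_C _).pow _)).mul ((monic_X_sub_C _).pow _)
  have hd2 : ((X - C 1) ^ a * (X - C j) ^ b * (X - C (j ^ 2)) ^ b : ℂ[X]).natDegree = 2 ^ n := by
    rw [Monic.natDegree_mul (((monic_X_sub_C _).pow _).mul ((monic_X_sub_C _).pow _))
      ((monic_X_sub_C _).pow _), Monic.natDegree_mul ((monic_X_sub_C _).pow _)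
      ((monic_X_sub_C _).pow _), natDegree_pow, natDegree_pow, natDegree_pow,
      natDegree_X_sub_C, natDegree_X_sub_C, natDegree_X_sub_C, mul_one, mul_one, hab]
  rw [Monic.natDegree_mul (monic_X_pow _) (Matrix.charpoly_monic _),
    Monic.natDegree_mul (monic_X_pow _) hmon, hd2, natDegree_X_pow, natDegree_X_pow,
    Matrix.charpoly_natDegree_eq_dim, Fintype.card_finset, Fintype.card_fin] at hdeg
  have hle : 2 ^ n ≤ 2 ^ ((N + 1) / 2) := Nat.pow_le_pow_right (by norm_num) (by omega)
  have hq : q = p + (2 ^ ((N + 1) / 2) - 2 ^ n) := by omega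
  rw [hq, pow_add, mul_assoc] at e
  have := mul_left_cancel₀ (pow_ne_zero p X_ne_zero) e
  rw [this]
  ring
end

section
/- Let N ≥ 1 with N ≡ 1 (mod 3). Then the complex transfer matrix 𝕃_N (of size F_{N+1}, with rows and columns indexed by the subsets of {1,…,N} containing no two consecutive integers, and entry 𝕃_N(C,D) = i^{|C|+|D|} if C ∩ (D+1) = ∅, and 0 otherwise) is nilpotent: all its eigenvalues are 0, i.e. its characteristic polynomial is X^{F_{N+1}}. -/
open Polynomial

/-- The Fibonacci numbers with the convention `F 0 = F 1 = 1`. -/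
def F (n : ℕ) : ℕ := Nat.fib (n + 1)

/-- The index set of the transfer matrix: subsets of `{1,…,N}` containing no two
consecutive integers (independent sets of a path with `N` vertices), encoded as
subsets `C` of `Fin N`, where `k : Fin N` represents the integer `k + 1`. -/
abbrev PathIndep (N : ℕ) :=
  {C : Finset (Fin N) // ∀ c ∈ C, ∀ d ∈ C, (c : ℕ) ≠ (d : ℕ) + 1}

/-- The transfer matrix `𝕃_N`, of size `F_{N+1}`, with rows and columns indexed by the
subsets of `{1,…,N}` with no two consecutive elements: the entry in row `C` and column
`D` is `i^(|C|+|D|)` if `C ∩ (D+1) = ∅` (no element of `C` equals an element of `D`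
plus one), and `0` otherwise. -/
def Lmat (N : ℕ) : Matrix (PathIndep N) (PathIndep N) ℂ :=
  fun C D =>
    if ∀ c ∈ C.1, ∀ d ∈ D.1, (c : ℕ) ≠ (d : ℕ) + 1
    then Complex.I ^ (C.1.card + D.1.card) else 0

/-- Independent sets of a path as finsets of naturals. -/
def natIndep (n : ℕ) : Finset (Finset ℕ) :=
  (Finset.range n).powerset.filter (fun C => ∀ c ∈ C, ∀ d ∈ C, c ≠ d + 1)

lemma natIndep_card : ∀ n, (natIndep n).card = Nat.fib (n + 2)
  | 0 => by decide
  | 1 => by decide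
  | n + 2 => by
    have h : natIndep (n + 2) = natIndep (n + 1) ∪ (natIndep n).image (insert (n + 1)) := by
      ext S
      simp only [natIndep, Finset.mem_union, Finset.mem_image, Finset.mem_filter,
        Finset.mem_powerset]
      constructor
      · rintro ⟨h1, h2⟩
        by_cases hS : n + 1 ∈ S
        · right
          refine ⟨S.erase (n + 1), ⟨?_, ?_⟩, Finset.insert_erase hS⟩
          · intro x hx
            rw [Finset.mem_erase] at hx
            have := Finset.mem_range.1 (h1 hx.2)
            have h3 : x ≠ n := by
              rintro rfl
              exact h2 _ hS _ hx.2 rfl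
            rw [Finset.mem_range]
            have := hx.1
            omega
          · intro c hc d hd
            exact h2 c (Finset.mem_of_mem_erase hc) d (Finset.mem_of_mem_erase hd)
        · left
          refine ⟨?_, h2⟩
          intro x hx
          have := Finset.mem_range.1 (h1 hx)
          have h3 : x ≠ n + 1 := by
            rintro rfl
            exact hS hx
          rw [Finset.mem_range]
          omega
      · rintro (⟨h1, h2⟩ | ⟨T, ⟨h1, h2⟩, rfl⟩)
        · exact ⟨h1.trans (Finset.range_mono (by omega)), h2⟩
        · have h3 : ∀ x ∈ T, x < n := fun x hx => Finset.mem_range.1 (h1 hx)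
          refine ⟨?_, ?_⟩
          · intro x hx
            rw [Finset.mem_insert] at hx
            rw [Finset.mem_range]
            rcases hx with rfl | hx
            · omega
            · have := h3 x hx
              omega
          · intro c hc d hd
            rw [Finset.mem_insert] at hc hd
            rcases hc with rfl | hc <;> rcases hd with rfl | hd
            · omega
            · have := h3 d hd
              omega
            · have := h3 c hc
              omega
            · exact h2 c hc d hd
    have hnot : ∀ T ∈ natIndep n, n + 1 ∉ T := by
      intro T hT h
      simp only [natIndep, Finset.mem_filter, Finset.mem_powerset] at hT
      have := Finset.mem_range.1 (hT.1 h)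
      omega
    rw [h, Finset.card_union_of_disjoint, Finset.card_image_of_injOn, natIndep_card (n + 1),
      natIndep_card n, Nat.fib_add_two (n := n + 2)]
    · ring
    · intro A hA B hB hAB
      have := congrArg (fun S => Finset.erase S (n + 1)) hAB
      simpa [Finset.erase_insert, hnot A hA, hnot B hB] using this
    · rw [Finset.disjoint_left]
      intro S hS hS'
      obtain ⟨T, -, rfl⟩ := Finset.mem_image.1 hS'
      simp only [natIndep, Finset.mem_filter, Finset.mem_powerset] at hS
      have := Finset.mem_range.1 (hS.1 (Finset.mem_insert_self _ _))
      omega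

lemma card_pathIndep (N : ℕ) : Fintype.card (PathIndep N) = Nat.fib (N + 2) := by
  rw [← natIndep_card N, ← Finset.card_univ]
  refine Finset.card_bij (fun C _ => C.1.map Fin.valEmbedding) ?_ ?_ ?_
  · rintro ⟨C, hC⟩ -
    simp only [natIndep, Finset.mem_filter, Finset.mem_powerset]
    refine ⟨?_, ?_⟩
    · intro x hx
      obtain ⟨y, -, rfl⟩ := Finset.mem_map.1 hx
      simp
    · intro c hc d hd
      obtain ⟨c', hc', rfl⟩ := Finset.mem_map.1 hc
      obtain ⟨d', hd', rfl⟩ := Finset.mem_map.1 hd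
      exact hC c' hc' d' hd'
  · rintro A - B - h
    exact Subtype.ext (Finset.map_injective _ h)
  · intro S hS
    simp only [natIndep, Finset.mem_filter, Finset.mem_powerset] at hS
    refine ⟨⟨Finset.univ.filter (fun x : Fin N => (x : ℕ) ∈ S), ?_⟩, Finset.mem_univ _, ?_⟩
    · intro c hc d hd
      exact hS.2 _ (Finset.mem_filter.1 hc).2 _ (Finset.mem_filter.1 hd).2
    · ext x
      simp only [Finset.mem_map, Finset.mem_filter, Finset.mem_univ, true_and,
        Fin.valEmbedding_apply]
      constructor
      · rintro ⟨y, hy, rfl⟩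
        exact hy
      · intro hx
        exact ⟨⟨x, Finset.mem_range.1 (hS.1 hx)⟩, hx, rfl⟩

/-- Toggling the first vertex, where allowed. -/
def toggle {N : ℕ} (S : PathIndep (N + 1)) : PathIndep (N + 1) :=
  if h0 : (0 : Fin (N + 1)) ∈ S.1 then
    ⟨S.1.erase 0, fun c hc d hd =>
      S.2 c (Finset.mem_of_mem_erase hc) d (Finset.mem_of_mem_erase hd)⟩
  else if h1 : ∀ s ∈ S.1, (s : ℕ) ≠ 1 then
    ⟨insert 0 S.1, by
      intro c hc d hd
      rw [Finset.mem_insert] at hc hd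
      rcases hc with rfl | hc
      · simp
      · rcases hd with rfl | hd
        · simpa using h1 c hc
        · exact S.2 c hc d hd⟩
  else S

lemma toggle_erase {N : ℕ} (S : PathIndep (N + 1)) (h0 : (0 : Fin (N + 1)) ∈ S.1) :
    (toggle S).1 = S.1.erase 0 := by
  simp [toggle, h0]

lemma toggle_insert {N : ℕ} (S : PathIndep (N + 1)) (h0 : (0 : Fin (N + 1)) ∉ S.1)
    (h1 : ∀ s ∈ S.1, (s : ℕ) ≠ 1) :
    (toggle S).1 = insert 0 S.1 := by
  unfold toggle
  rw [dif_neg h0, dif_pos h1]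

lemma toggle_toggle {N : ℕ} (S : PathIndep (N + 1)) : toggle (toggle S) = S := by
  apply Subtype.ext
  by_cases h0 : (0 : Fin (N + 1)) ∈ S.1
  · have h := toggle_erase S h0
    rw [toggle_insert, h, Finset.insert_erase h0]
    · simp [h]
    · rw [h]
      intro s hs
      simpa using S.2 s (Finset.mem_of_mem_erase hs) 0 h0
  · by_cases h1 : ∀ s ∈ S.1, (s : ℕ) ≠ 1
    · have h := toggle_insert S h0 h1
      rw [toggle_erase, h, Finset.erase_insert h0]
      simp [h]
    · have : toggle S = S := by
        unfold toggle
        rw [dif_neg h0, dif_neg h1]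
      rw [this, this]

lemma Lmat_insert_left {N : ℕ} (S T D : PathIndep (N + 1)) (h0 : (0 : Fin (N + 1)) ∉ S.1)
    (h : T.1 = insert 0 S.1) : Lmat (N + 1) T D = Complex.I * Lmat (N + 1) S D := by
  have hc : T.1.card = S.1.card + 1 := by rw [h, Finset.card_insert_of_notMem h0]
  have hiff : (∀ c ∈ T.1, ∀ d ∈ D.1, (c : ℕ) ≠ (d : ℕ) + 1) ↔
      (∀ c ∈ S.1, ∀ d ∈ D.1, (c : ℕ) ≠ (d : ℕ) + 1) := by
    rw [h]
    simp
  unfold Lmat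
  simp only [hiff, hc]
  split_ifs
  · ring
  · simp

lemma Lmat_insert_right {N : ℕ} (C S T : PathIndep (N + 1)) (h0 : (0 : Fin (N + 1)) ∉ S.1)
    (h : T.1 = insert 0 S.1) (hC : ∀ c ∈ C.1, (c : ℕ) ≠ 1) :
    Lmat (N + 1) C T = Complex.I * Lmat (N + 1) C S := by
  have hc : T.1.card = S.1.card + 1 := by rw [h, Finset.card_insert_of_notMem h0]
  have hiff : (∀ c ∈ C.1, ∀ d ∈ T.1, (c : ℕ) ≠ (d : ℕ) + 1) ↔
      (∀ c ∈ C.1, ∀ d ∈ S.1, (c : ℕ) ≠ (d : ℕ) + 1) := by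
    rw [h]
    constructor
    · intro H c hc d hd
      exact H c hc d (Finset.mem_insert_of_mem hd)
    · intro H c hc d hd
      rcases Finset.mem_insert.1 hd with rfl | hd
      · simpa using hC c hc
      · exact H c hc d hd
  unfold Lmat
  simp only [hiff, hc]
  split_ifs
  · ring
  · simp

lemma Lmat_sq_zero {N : ℕ} (C D : PathIndep (N + 1)) (hC : ∀ c ∈ C.1, (c : ℕ) ≠ 1)
    (hS : ∀ S : PathIndep (N + 1), Lmat (N + 1) C S ≠ 0 → ∀ s ∈ S.1, (s : ℕ) ≠ 1) :
    (Lmat (N + 1) ^ 2) C D = 0 := by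
  have key : ∀ S T : PathIndep (N + 1), (0 : Fin (N + 1)) ∉ S.1 → T.1 = insert 0 S.1 →
      Lmat (N + 1) C S * Lmat (N + 1) S D + Lmat (N + 1) C T * Lmat (N + 1) T D = 0 := by
    intro S T h0 h
    rw [Lmat_insert_left S T D h0 h, Lmat_insert_right C S T h0 h hC]
    linear_combination (Lmat (N + 1) C S * Lmat (N + 1) S D) * Complex.I_mul_I
  rw [pow_two, Matrix.mul_apply]
  refine Finset.sum_involution (fun S _ => toggle S) ?_ ?_ (fun _ _ => Finset.mem_univ _)
    (fun S _ => toggle_toggle S)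
  · intro S _
    by_cases h0 : (0 : Fin (N + 1)) ∈ S.1
    · have h := toggle_erase S h0
      rw [add_comm]
      apply key
      · simp [h]
      · rw [h, Finset.insert_erase h0]
    · by_cases h1 : ∀ s ∈ S.1, (s : ℕ) ≠ 1
      · exact key _ _ h0 (toggle_insert S h0 h1)
      · have h2 : Lmat (N + 1) C S = 0 := by
          by_contra h3
          exact h1 (hS S h3)
        have : toggle S = S := by
          unfold toggle
          rw [dif_neg h0, dif_neg h1]
        rw [this, h2]
        simp
  · intro S _ hne heq
    have h1 := hS S (left_ne_zero_of_mul hne)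
    have heq' := congrArg Subtype.val heq
    by_cases h0 : (0 : Fin (N + 1)) ∈ S.1
    · rw [toggle_erase S h0] at heq'
      rw [← heq'] at h0
      simp at h0
    · rw [toggle_insert S h0 h1] at heq'
      rw [← heq'] at h0
      simp at h0

/-- Gluing an independent set on two vertices, a gap, and an independent set on `N`. -/
def glue {N : ℕ} (p : PathIndep 2 × PathIndep N) : PathIndep (N + 3) :=
  ⟨(p.1.1.map (Fin.castLEEmb (by omega))).disjUnion
      (p.2.1.map (Fin.natAddEmb 3 |>.trans (finCongr (Nat.add_comm 3 N)).toEmbedding)) (by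
        rw [Finset.disjoint_left]
        intro x hx hy
        obtain ⟨a, -, rfl⟩ := Finset.mem_map.1 hx
        obtain ⟨b, -, hb⟩ := Finset.mem_map.1 hy
        have := congrArg Fin.val hb
        have := a.2
        simp at *
        omega), by
    intro c hc d hd
    simp only [Finset.mem_disjUnion, Finset.mem_map] at hc hd
    rcases hc with ⟨a, ha, rfl⟩ | ⟨a, ha, rfl⟩ <;> rcases hd with ⟨b, hb, rfl⟩ | ⟨b, hb, rfl⟩
    · simpa using p.1.2 a ha b hb
    · have := a.2
      simp
      omega
    · have := b.2
      simp
      omega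
    · have := p.2.2 a ha b hb
      simp
      omega⟩

lemma glue_card {N : ℕ} (p : PathIndep 2 × PathIndep N) :
    (glue p).1.card = p.1.1.card + p.2.1.card := by
  unfold glue
  rw [Finset.card_disjUnion, Finset.card_map, Finset.card_map]

lemma mem_glue {N : ℕ} (p : PathIndep 2 × PathIndep N) (x : Fin (N + 3)) :
    x ∈ (glue p).1 ↔ (∃ a ∈ p.1.1, (a : ℕ) = x) ∨ (∃ b ∈ p.2.1, (b : ℕ) + 3 = x) := by
  simp [glue, Fin.ext_iff]

lemma glue_injective {N : ℕ} : Function.Injective (glue (N := N)) := by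
  rintro ⟨a, b⟩ ⟨a', b'⟩ h
  have h1 : ∀ x, x ∈ (glue (a, b)).1 ↔ x ∈ (glue (a', b')).1 := by
    rw [h]
    simp
  simp only [mem_glue] at h1
  ext x
  · have := h1 ⟨x, by omega⟩
    have hx := x.2
    constructor
    · intro hm
      rcases this.1 (Or.inl ⟨x, hm, rfl⟩) with ⟨y, hy, e⟩ | ⟨y, hy, e⟩
      · rwa [← Fin.ext e]
      · simp at e
        omega
    · intro hm
      rcases this.2 (Or.inl ⟨x, hm, rfl⟩) with ⟨y, hy, e⟩ | ⟨y, hy, e⟩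
      · rwa [← Fin.ext e]
      · simp at e
        omega
  · have := h1 ⟨x + 3, by omega⟩
    constructor
    · intro hm
      rcases this.1 (Or.inr ⟨x, hm, rfl⟩) with ⟨y, hy, e⟩ | ⟨y, hy, e⟩
      · have := y.2
        simp at e
        omega
      · have e' : y = x := Fin.ext (by simpa using e)
        rwa [← e']
    · intro hm
      rcases this.2 (Or.inr ⟨x, hm, rfl⟩) with ⟨y, hy, e⟩ | ⟨y, hy, e⟩
      · have := y.2
        simp at e
        omega
      · have e' : y = x := Fin.ext (by simpa using e)
        rwa [← e']

lemma glue_surj {N : ℕ} (S : PathIndep (N + 3)) (hS : ∀ s ∈ S.1, (s : ℕ) ≠ 2) :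
    ∃ p, glue p = S := by
  refine ⟨(⟨Finset.univ.filter (fun x : Fin 2 => (⟨x, by omega⟩ : Fin (N + 3)) ∈ S.1), ?_⟩,
    ⟨Finset.univ.filter (fun x : Fin N => (⟨x + 3, by omega⟩ : Fin (N + 3)) ∈ S.1), ?_⟩), ?_⟩
  · intro c hc d hd
    exact S.2 _ (Finset.mem_filter.1 hc).2 _ (Finset.mem_filter.1 hd).2
  · intro c hc d hd
    have := S.2 _ (Finset.mem_filter.1 hc).2 _ (Finset.mem_filter.1 hd).2
    simp at this
    omega
  · ext x
    rw [mem_glue]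
    simp only [Finset.mem_filter, Finset.mem_univ, true_and]
    constructor
    · rintro (⟨a, ha, e⟩ | ⟨a, ha, e⟩)
      · have e' : x = ⟨a, by omega⟩ := Fin.ext e.symm
        rw [e']
        exact ha
      · have e' : x = ⟨a + 3, by omega⟩ := Fin.ext e.symm
        rw [e']
        exact ha
    · intro hx
      have h2 := hS x hx
      by_cases h : (x : ℕ) < 2
      · exact Or.inl ⟨⟨x, h⟩, hx, rfl⟩
      · refine Or.inr ⟨⟨x - 3, by omega⟩, ?_, ?_⟩
        · convert hx using 1
          apply Fin.ext
          simp
          omega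
        · simp
          omega

open scoped Kronecker in
lemma Lmat_glue {N : ℕ} :
    (Lmat (N + 3)).submatrix glue glue = Lmat 2 ⊗ₖ Lmat N := by
  ext ⟨a, b⟩ ⟨a', b'⟩
  rw [Matrix.submatrix_apply, Matrix.kronecker_apply]
  have hiff : (∀ c ∈ (glue (a, b)).1, ∀ d ∈ (glue (a', b')).1, (c : ℕ) ≠ (d : ℕ) + 1) ↔
      (∀ c ∈ a.1, ∀ d ∈ a'.1, (c : ℕ) ≠ (d : ℕ) + 1) ∧
      (∀ c ∈ b.1, ∀ d ∈ b'.1, (c : ℕ) ≠ (d : ℕ) + 1) := by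
    simp only [mem_glue]
    constructor
    · intro H
      refine ⟨fun c hc d hd => ?_, fun c hc d hd => ?_⟩
      · exact H ⟨c, by omega⟩ (Or.inl ⟨c, hc, rfl⟩) ⟨d, by omega⟩ (Or.inl ⟨d, hd, rfl⟩)
      · have := H ⟨c + 3, by omega⟩ (Or.inr ⟨c, hc, rfl⟩) ⟨d + 3, by omega⟩
          (Or.inr ⟨d, hd, rfl⟩)
        simp at this
        omega
    · rintro ⟨H1, H2⟩ c (⟨x, hx, e⟩ | ⟨x, hx, e⟩) d (⟨y, hy, e'⟩ | ⟨y, hy, e'⟩)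
      · have := H1 x hx y hy
        omega
      · have := x.2
        omega
      · have := y.2
        omega
      · have := H2 x hx y hy
        omega
  unfold Lmat
  simp only [hiff, glue_card]
  by_cases h1 : (∀ c ∈ a.1, ∀ d ∈ a'.1, (c : ℕ) ≠ (d : ℕ) + 1) <;>
  by_cases h2 : (∀ c ∈ b.1, ∀ d ∈ b'.1, (c : ℕ) ≠ (d : ℕ) + 1)
  · rw [if_pos ⟨h1, h2⟩, if_pos h1, if_pos h2]
    ring
  · rw [if_neg (fun h => h2 h.2), if_neg h2, mul_zero]
  · rw [if_neg (fun h => h1 h.1), if_neg h1, zero_mul]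
  · rw [if_neg (fun h => h2 h.2), if_neg h2, mul_zero]

lemma Lmat_sq_zero_of_two {N : ℕ} (C D : PathIndep (N + 3))
    (hC : ¬ ∀ s ∈ C.1, (s : ℕ) ≠ 2) : (Lmat (N + 3) ^ 2) C D = 0 := by
  push Not at hC
  obtain ⟨z, hz, hz2⟩ := hC
  apply Lmat_sq_zero
  · intro c hc h
    exact C.2 z hz c hc (by omega)
  · intro S hne s hs h
    apply hne
    unfold Lmat
    rw [if_neg]
    intro H
    exact H z hz s hs (by omega)

lemma Lmat_pow_zero_of_two {N : ℕ} (j : ℕ) (C D : PathIndep (N + 3))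
    (hC : ¬ ∀ s ∈ C.1, (s : ℕ) ≠ 2) : (Lmat (N + 3) ^ (j + 2)) C D = 0 := by
  rw [add_comm j 2, pow_add, Matrix.mul_apply]
  exact Finset.sum_eq_zero (fun S _ => by rw [Lmat_sq_zero_of_two C S hC, zero_mul])

open scoped Kronecker in
lemma kron_pow {m n : Type*} [Fintype m] [Fintype n] [DecidableEq m] [DecidableEq n]
    (A : Matrix m m ℂ) (B : Matrix n n ℂ) (j : ℕ) : (A ⊗ₖ B) ^ j = (A ^ j) ⊗ₖ (B ^ j) := by
  induction j with
  | zero => simp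
  | succ j ih => rw [pow_succ, pow_succ, pow_succ, ih, Matrix.mul_kronecker_mul]

lemma sum_assoc_aux {n : Type*} [Fintype n] (a : n → ℂ) (B : n → n → ℂ) (g : n → ℂ) :
    ∑ q, a q * ∑ t, B q t * g t = ∑ t, (∑ q, a q * B q t) * g t := by
  simp only [Finset.mul_sum, Finset.sum_mul]
  rw [Finset.sum_comm]
  simp only [mul_assoc]

lemma Lmat_pow_glue {N : ℕ} (j : ℕ) (p : PathIndep 2 × PathIndep N) (D : PathIndep (N + 3)) :
    (Lmat (N + 3) ^ (j + 2)) (glue p) D =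
      ∑ q, (((Lmat (N + 3)).submatrix glue glue) ^ j) p q * (Lmat (N + 3) ^ 2) (glue q) D := by
  induction j generalizing p with
  | zero =>
    simp [Matrix.one_apply]
  | succ j ih =>
    rw [show j + 1 + 2 = (j + 2) + 1 by ring, pow_succ', Matrix.mul_apply]
    have : ∑ S, Lmat (N + 3) (glue p) S * (Lmat (N + 3) ^ (j + 2)) S D =
        ∑ q, Lmat (N + 3) (glue p) (glue q) * (Lmat (N + 3) ^ (j + 2)) (glue q) D := by
      symm
      refine Finset.sum_of_injOn glue glue_injective.injOn (by simp) ?_ (by simp)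
      intro S _ hS
      have h2 : ¬ ∀ s ∈ S.1, (s : ℕ) ≠ 2 := by
        intro h
        obtain ⟨p, rfl⟩ := glue_surj S h
        exact hS (by simp)
      rw [Lmat_pow_zero_of_two j S D h2, mul_zero]
    rw [this]
    calc _ = ∑ q, ((Lmat (N + 3)).submatrix glue glue) p q *
          ∑ t, (((Lmat (N + 3)).submatrix glue glue) ^ j) q t *
            (Lmat (N + 3) ^ 2) (glue t) D :=
          Finset.sum_congr rfl (fun q _ => by rw [ih q]; rfl)
      _ = _ := sum_assoc_aux _ _ _
      _ = _ := Finset.sum_congr rfl (fun t _ => by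
          rw [pow_succ' ((Lmat (N + 3)).submatrix glue glue) j, Matrix.mul_apply])

lemma Lmat_step {N j : ℕ} (h : Lmat N ^ j = 0) : Lmat (N + 3) ^ (j + 2) = 0 := by
  ext C D
  by_cases hC : ∀ s ∈ C.1, (s : ℕ) ≠ 2
  · obtain ⟨p, rfl⟩ := glue_surj C hC
    rw [Lmat_pow_glue, Lmat_glue, kron_pow, h, Matrix.kronecker_zero]
    simp
  · rw [Lmat_pow_zero_of_two j C D hC]
    rfl

lemma Lmat_nilp (n : ℕ) : Lmat (3 * n + 1) ^ (2 * n + 2) = 0 := by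
  induction n with
  | zero =>
    ext C D
    have : ∀ (C : PathIndep 1), ∀ c ∈ C.1, (c : ℕ) ≠ 1 := by
      intro C c _
      omega
    exact Lmat_sq_zero (N := 0) C D (this C) (fun S _ => this S)
  | succ n ih => exact Lmat_step ih

/-- For `N ≡ 1 (mod 3)`, the transfer matrix `𝕃_N` is nilpotent: its characteristic
polynomial is `X^(F_{N+1})`. -/
theorem Lmat_charpoly_N1 (N : ℕ) (hN : 1 ≤ N) (hN3 : N % 3 = 1) :
    (Lmat N).charpoly = X ^ F (N + 1) := by
  obtain ⟨n, rfl⟩ : ∃ n, N = 3 * n + 1 := ⟨N / 3, by omega⟩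
  have h := Matrix.isNilpotent_charpoly_sub_pow_of_isNilpotent
    (M := Lmat (3 * n + 1)) ⟨_, Lmat_nilp n⟩
  have h2 := sub_eq_zero.1 h.eq_zero
  rw [h2, card_pathIndep, F]
end
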